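/- Let E > 0, −1 < ν < 1/2, and let 𝒞 be the isotropic map 𝒞(A) = (E/(1+ν))·(A + (ν/(1−2ν))·tr(A)·I). Let D ∈ Sym have ordered eigenvalues d₁ ≤ d₂ ≤ d₃. If d₁ + (ν/(1−2ν))·(d₁+d₂+d₃) ≥ 0, then the zero matrix is the unique minimizer over Sym⁻ of Y ↦ (D−Y)•𝒞(D−Y). -/

import Mathlib

open Matrix

/-- The Frobenius inner product `A • B = tr(Aᵀ B)` on 3×3 real matrices. -/
noncomputable def frob (A B : Matrix (Fin 3) (Fin 3) ℝ) : ℝ := (Aᵀ * B).trace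

/-- Membership in the cone `Sym⁻` of negative semidefinite symmetric matrices. -/
def negSD (Y : Matrix (Fin 3) (Fin 3) ℝ) : Prop := Y.IsSymm ∧ (-Y).PosSemidef

/-- The isotropic tensor with Young's modulus `E` and Poisson's ratio `ν`:
`𝒞(A) = (E/(1+ν))·(A + (ν/(1−2ν))·tr(A)·I)`. -/
noncomputable def isoC (E ν : ℝ) (A : Matrix (Fin 3) (Fin 3) ℝ) :
    Matrix (Fin 3) (Fin 3) ℝ :=
  (E / (1 + ν)) • (A + (ν / (1 - 2 * ν)) • A.trace • (1 : Matrix (Fin 3) (Fin 3) ℝ))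

theorem trace_eq_sum_dotProduct_mulVec (A : Matrix (Fin 3) (Fin 3) ℝ) {q₁ q₂ q₃ : Fin 3 → ℝ}
    (hn₁ : q₁ ⬝ᵥ q₁ = 1) (hn₂ : q₂ ⬝ᵥ q₂ = 1) (hn₃ : q₃ ⬝ᵥ q₃ = 1)
    (ho₁₂ : q₁ ⬝ᵥ q₂ = 0) (ho₁₃ : q₁ ⬝ᵥ q₃ = 0) (ho₂₃ : q₂ ⬝ᵥ q₃ = 0) :
    A.trace = q₁ ⬝ᵥ A *ᵥ q₁ + q₂ ⬝ᵥ A *ᵥ q₂ + q₃ ⬝ᵥ A *ᵥ q₃ := by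
  let Q : Matrix (Fin 3) (Fin 3) ℝ := Matrix.of ![q₁, q₂, q₃]
  have hQ : Q * Qᵀ = 1 := by
    ext i j
    change ![q₁, q₂, q₃] i ⬝ᵥ ![q₁, q₂, q₃] j = _
    fin_cases i <;> fin_cases j <;>
      simp [hn₁, hn₂, hn₃, ho₁₂, ho₁₃, ho₂₃, dotProduct_comm q₂ q₁, dotProduct_comm q₃ q₁,
        dotProduct_comm q₃ q₂]
  have hA : A.trace = (Q * (A * Qᵀ)).trace := by
    rw [trace_mul_comm, Matrix.mul_assoc, mul_eq_one_comm.mp hQ, Matrix.mul_one]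
  rw [hA, trace_fin_three]
  rfl

theorem frob_self_pos {Y : Matrix (Fin 3) (Fin 3) ℝ} (hY : Y ≠ 0) : 0 < frob Y Y := by
  have h := (posSemidef_conjTranspose_mul_self Y).trace_nonneg
  rw [conjTranspose_eq_transpose_of_trivial] at h
  refine lt_of_le_of_ne h fun h0 => hY ?_
  rw [← trace_conjTranspose_mul_self_eq_zero_iff, conjTranspose_eq_transpose_of_trivial]
  exact h0.symm

theorem trace_sq_le_three_mul_frob_self (Y : Matrix (Fin 3) (Fin 3) ℝ) :
    Y.trace ^ 2 ≤ 3 * frob Y Y := by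
  simp only [frob, trace_fin_three, mul_apply, transpose_apply, Fin.sum_univ_three]
  nlinarith [sq_nonneg (Y 0 0 - Y 1 1), sq_nonneg (Y 0 0 - Y 2 2), sq_nonneg (Y 1 1 - Y 2 2),
    sq_nonneg (Y 0 1), sq_nonneg (Y 0 2), sq_nonneg (Y 1 0), sq_nonneg (Y 1 2),
    sq_nonneg (Y 2 0), sq_nonneg (Y 2 1)]

theorem frob_self_add_mul_trace_sq_pos {k : ℝ} (hk : 0 < 1 + 3 * k)
    {Y : Matrix (Fin 3) (Fin 3) ℝ} (hY : Y ≠ 0) : 0 < frob Y Y + k * Y.trace ^ 2 := by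
  have h := frob_self_pos hY
  rcases le_total 0 k with h0 | h0
  · positivity
  · nlinarith [trace_sq_le_three_mul_frob_self Y]

theorem frob_isoC_self (E ν : ℝ) (A : Matrix (Fin 3) (Fin 3) ℝ) :
    frob A (isoC E ν A) = E / (1 + ν) * (frob A A + ν / (1 - 2 * ν) * A.trace ^ 2) := by
  simp only [frob, isoC, Matrix.mul_smul, Matrix.mul_add, Matrix.mul_one, trace_smul, trace_add,
    trace_transpose, smul_eq_mul]
  ring

theorem frob_sub_self (D Y : Matrix (Fin 3) (Fin 3) ℝ) (hD : D.IsSymm) (hY : Y.IsSymm) :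
    frob (D - Y) (D - Y) = frob D D - 2 * (Y * D).trace + frob Y Y := by
  simp only [frob, transpose_sub, hD.eq, hY.eq, Matrix.sub_mul, Matrix.mul_sub, trace_sub,
    trace_mul_comm D Y]
  ring

/-- Isotropic case: if `d₁ + (ν/(1−2ν))(d₁+d₂+d₃) ≥ 0` then `P_𝒞(D) = 0` is the unique
minimizer over `Sym⁻` of `Y ↦ (D−Y)•𝒞(D−Y)`. -/
theorem isoC_proj_zero_case (E ν : ℝ) (hE : 0 < E) (hν₁ : -1 < ν) (hν₂ : ν < 1 / 2)
    (D : Matrix (Fin 3) (Fin 3) ℝ) (hD : D.IsSymm)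
    (d₁ d₂ d₃ : ℝ) (h12 : d₁ ≤ d₂) (h23 : d₂ ≤ d₃)
    (q₁ q₂ q₃ : Fin 3 → ℝ)
    (hq₁ : D *ᵥ q₁ = d₁ • q₁) (hq₂ : D *ᵥ q₂ = d₂ • q₂) (hq₃ : D *ᵥ q₃ = d₃ • q₃)
    (hn₁ : q₁ ⬝ᵥ q₁ = 1) (hn₂ : q₂ ⬝ᵥ q₂ = 1) (hn₃ : q₃ ⬝ᵥ q₃ = 1)
    (ho₁₂ : q₁ ⬝ᵥ q₂ = 0) (ho₁₃ : q₁ ⬝ᵥ q₃ = 0) (ho₂₃ : q₂ ⬝ᵥ q₃ = 0)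
    (hcase : 0 ≤ d₁ + (ν / (1 - 2 * ν)) * (d₁ + d₂ + d₃)) :
    (∀ Y : Matrix (Fin 3) (Fin 3) ℝ, negSD Y →
        frob (D - 0) (isoC E ν (D - 0)) ≤ frob (D - Y) (isoC E ν (D - Y))) ∧
      ∀ Ystar : Matrix (Fin 3) (Fin 3) ℝ, negSD Ystar →
        (∀ Y : Matrix (Fin 3) (Fin 3) ℝ, negSD Y →
          frob (D - Ystar) (isoC E ν (D - Ystar)) ≤ frob (D - Y) (isoC E ν (D - Y))) →
        Ystar = 0 := by
  have hν : 0 < 1 - 2 * ν := by linarith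
  have hc : 0 < E / (1 + ν) := div_pos hE (by linarith)
  have hk : 0 < 1 + 3 * (ν / (1 - 2 * ν)) := by
    have : 1 + 3 * (ν / (1 - 2 * ν)) = (1 + ν) / (1 - 2 * ν) := by
      have hne := hν.ne'
      rw [eq_div_iff hne, add_mul, mul_assoc, div_mul_cancel₀ _ hne]
      ring
    rw [this]
    exact div_pos (by linarith) hν
  have key : ∀ Y : Matrix (Fin 3) (Fin 3) ℝ, negSD Y → Y ≠ 0 →
      frob (D - 0) (isoC E ν (D - 0)) < frob (D - Y) (isoC E ν (D - Y)) := by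
    rintro Y ⟨hs, hn⟩ h0
    have htr (A : Matrix (Fin 3) (Fin 3) ℝ) :=
      trace_eq_sum_dotProduct_mulVec A hn₁ hn₂ hn₃ ho₁₂ ho₁₃ ho₂₃
    have hDt : D.trace = d₁ + d₂ + d₃ := by
      simp [htr, hq₁, hq₂, hq₃, hn₁, hn₂, hn₃]
    have hYD : (Y * D).trace =
        d₁ * (q₁ ⬝ᵥ Y *ᵥ q₁) + d₂ * (q₂ ⬝ᵥ Y *ᵥ q₂) + d₃ * (q₃ ⬝ᵥ Y *ᵥ q₃) := by
      simp [htr, ← mulVec_mulVec, hq₁, hq₂, hq₃, mulVec_smul]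
    have hquad (q : Fin 3 → ℝ) : q ⬝ᵥ Y *ᵥ q ≤ 0 := by
      simpa [neg_mulVec] using hn.dotProduct_mulVec_nonneg q
    have hpos := frob_self_add_mul_trace_sq_pos hk h0
    have hcross : (Y * D).trace + ν / (1 - 2 * ν) * (D.trace * Y.trace) ≤ 0 := by
      rw [hYD, hDt, htr Y]
      set k := ν / (1 - 2 * ν)
      have h₁ := mul_nonpos_of_nonneg_of_nonpos hcase (hquad q₁)
      have h₂ := mul_nonpos_of_nonneg_of_nonpos
        (show 0 ≤ d₂ + k * (d₁ + d₂ + d₃) by linarith) (hquad q₂)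
      have h₃ := mul_nonpos_of_nonneg_of_nonpos
        (show 0 ≤ d₃ + k * (d₁ + d₂ + d₃) by linarith) (hquad q₃)
      linarith
    rw [sub_zero, frob_isoC_self, frob_isoC_self, frob_sub_self D Y hD hs, trace_sub]
    refine mul_lt_mul_of_pos_left ?_ hc
    linarith
  refine ⟨fun Y hY => ?_, fun Y hY hmin => ?_⟩
  · rcases eq_or_ne Y 0 with rfl | h0
    · exact le_rfl
    · exact (key Y hY h0).le
  · by_contra h0
    exact (key Y hY h0).not_ge (hmin 0 ⟨isSymm_zero, by simpa using PosSemidef.zero⟩)
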